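/- arXiv:2511.12527 — 6 statements merged into one kernel-verified Lean document; each statement's English description precedes it below -/
import Mathlib

section
/- Let n1, n2 ≥ 2 be integers and let x ≠ y be real numbers. Let z1, z2 ∈ ℂ satisfy z1² = x and z2² = y, and assume the pair (z1,z2) is (n1,n2)-independent. Then the characteristic polynomial of K(n1,n2,x,y), regarded as a complex matrix, equals ∏_{u=0}^{n1−1} ∏_{v=0}^{n2−1} (X − λ_{uv}), where λ_{uv} := (n1−1−2u)z1 + (n2−1−2v)z2, and the n1·n2 complex numbers λ_{uv} are pairwise distinct; in particular K(n1,n2,x,y) has exactly n1·n2 simple eigenvalues. -/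
open Matrix Kronecker

noncomputable section

/-- The modified Kac matrix `𝒦(n,y)`: its 1-based entry `(i,j)` equals `(n-j)·y` if `j = i-1`,
equals `i` if `j = i+1`, and equals `0` otherwise. -/
def kacM (R : Type*) [CommRing R] (n : ℕ) (y : R) : Matrix (Fin n) (Fin n) R :=
  Matrix.of fun i j =>
    if (i : ℕ) = (j : ℕ) + 1 then ((n - 1 - (j : ℕ) : ℕ) : R) * y
    else if (j : ℕ) = (i : ℕ) + 1 then (((i : ℕ) + 1 : ℕ) : R)
    else 0

/-- The modified Kac matrix of second type `K(n1,n2,x,y)`, indexed by pairs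
`(block index, index inside block)`; the pair `(u,v)` (0-based) corresponds to the
1-based position `u·n2 + v + 1`.  Its `n2×n2` blocks `K_{ij}` (1-based) are
`𝒦(n2,y)` if `i = j`, `(n1-j)·x·I` if `j = i-1`, `i·I` if `j = i+1`, and `0` otherwise. -/
def kac2M (R : Type*) [CommRing R] (n1 n2 : ℕ) (x y : R) :
    Matrix (Fin n1 × Fin n2) (Fin n1 × Fin n2) R :=
  Matrix.of fun p q =>
    if p.1 = q.1 then kacM R n2 y p.2 q.2
    else if (p.1 : ℕ) = (q.1 : ℕ) + 1 then
      (if p.2 = q.2 then ((n1 - 1 - (q.1 : ℕ) : ℕ) : R) * x else 0)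
    else if (q.1 : ℕ) = (p.1 : ℕ) + 1 then
      (if p.2 = q.2 then (((p.1 : ℕ) + 1 : ℕ) : R) else 0)
    else 0

/-- A pair `(z1,z2)` of complex numbers is `(n1,n2)`-independent if, for all
`a1, b1 ∈ 𝒩₁ = {n1-1-2r : 0 ≤ r ≤ n1-1}` and `a2, b2 ∈ 𝒩₂ = {n2-1-2r : 0 ≤ r ≤ n2-1}`,
`(a1-b1)z1 + (a2-b2)z2 = 0` implies `a1 = b1` and `a2 = b2`. -/
def IndepPair (n1 n2 : ℕ) (z1 z2 : ℂ) : Prop :=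
  ∀ a1 b1 a2 b2 : ℤ,
    (∃ r : ℕ, r < n1 ∧ a1 = (n1 : ℤ) - 1 - 2 * r) →
    (∃ r : ℕ, r < n1 ∧ b1 = (n1 : ℤ) - 1 - 2 * r) →
    (∃ r : ℕ, r < n2 ∧ a2 = (n2 : ℤ) - 1 - 2 * r) →
    (∃ r : ℕ, r < n2 ∧ b2 = (n2 : ℤ) - 1 - 2 * r) →
    ((a1 - b1 : ℤ) : ℂ) * z1 + ((a2 - b2 : ℤ) : ℂ) * z2 = 0 →
    a1 = b1 ∧ a2 = b2

open Polynomial in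
/-- The generating polynomial of the eigenvector of the Kac matrix. -/
def kacPoly (z : ℂ) (a b : ℕ) : ℂ[X] := (1 + C z * X) ^ a * (1 - C z * X) ^ b

open Polynomial in
lemma kacPow_deriv (w : ℂ) (a : ℕ) :
    (1 + C w * X) * derivative ((1 + C w * X) ^ a) = C ((a : ℂ) * w) * (1 + C w * X) ^ a := by
  cases a with
  | zero => simp
  | succ a =>
    rw [derivative_pow_succ]
    simp only [derivative_add, derivative_one, derivative_mul, derivative_C, derivative_X, map_mul]
    push_cast
    simp only [map_add, map_natCast, map_one]
    ring

open Polynomial in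
lemma kacPoly_ode (z : ℂ) (a b : ℕ) :
    derivative (kacPoly z a b) + C (z ^ 2) * (C ((a + b : ℕ) : ℂ) * (X * kacPoly z a b)
      - X * (X * derivative (kacPoly z a b))) = C (((a : ℂ) - b) * z) * kacPoly z a b := by
  have hA := kacPow_deriv z a
  have hB := kacPow_deriv (-z) b
  have e : (1 + C (-z) * X : ℂ[X]) = 1 - C z * X := by simp [sub_eq_add_neg]
  rw [e] at hB
  unfold kacPoly
  rw [derivative_mul]
  generalize derivative ((1 + C z * X : ℂ[X]) ^ a) = A' at *
  generalize derivative ((1 - C z * X : ℂ[X]) ^ b) = B' at *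
  generalize hAA : ((1 + C z * X : ℂ[X]) ^ a) = A at *
  generalize hBB : ((1 - C z * X : ℂ[X]) ^ b) = B at *
  simp only [map_mul, map_neg, map_natCast, map_sub, map_pow, Nat.cast_add, map_add] at *
  linear_combination (1 - C z * X) * B * hA + (1 + C z * X) * A * hB

open Polynomial in
lemma kacPoly_natDegree (z : ℂ) (a b : ℕ) : (kacPoly z a b).natDegree ≤ a + b := by
  unfold kacPoly
  have h1 : (1 + C z * X : ℂ[X]).natDegree ≤ 1 := by compute_degree
  have h2 : (1 - C z * X : ℂ[X]).natDegree ≤ 1 := by compute_degree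
  refine natDegree_mul_le.trans (add_le_add ?_ ?_)
  · exact (natDegree_pow_le_of_le a h1).trans (by simp)
  · exact (natDegree_pow_le_of_le b h2).trans (by simp)

lemma kacPoly_coeff_zero (z : ℂ) (a b : ℕ) : (kacPoly z a b).coeff 0 = 1 := by
  simp [kacPoly, Polynomial.coeff_zero_eq_eval_zero]

lemma kacM_sum (n : ℕ) (y : ℂ) (f : ℕ → ℂ) (hf : f n = 0) (i : Fin n) :
    ∑ j : Fin n, kacM ℂ n y i j * f j =
      (if (i : ℕ) = 0 then 0 else ((n : ℂ) - (i : ℕ)) * y * f ((i : ℕ) - 1))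
        + (((i : ℕ) : ℂ) + 1) * f ((i : ℕ) + 1) := by
  obtain ⟨i, hi⟩ := i
  have h : ∀ j : Fin n, kacM ℂ n y ⟨i, hi⟩ j * f j =
      (fun k : ℕ => (if i = k + 1 then ((n : ℂ) - i) * y * f k else 0)
        + (if k = i + 1 then ((i : ℂ) + 1) * f k else 0)) (j : ℕ) := by
    rintro ⟨j, hj⟩
    simp only [kacM, Matrix.of_apply]
    by_cases h1 : i = j + 1
    · have h2 : ¬ j = i + 1 := by omega
      have h3 : n - 1 - j = n - i := by omega
      rw [if_pos h1, if_pos h1, if_neg h2, h3, Nat.cast_sub hi.le]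
      ring
    · rw [if_neg h1, if_neg h1]
      by_cases h2 : j = i + 1
      · simp [h2]
      · simp [h2]
  rw [Finset.sum_congr rfl (fun j _ => h j),
    Fin.sum_univ_eq_sum_range (fun k : ℕ => (if i = k + 1 then ((n : ℂ) - i) * y * f k else 0)
        + (if k = i + 1 then ((i : ℂ) + 1) * f k else 0)) n, Finset.sum_add_distrib]
  congr 1
  · cases i with
    | zero => simp
    | succ m =>
      simp only [Nat.add_right_cancel_iff]
      rw [Finset.sum_ite_eq]
      simp [show m < n by omega]
  · rw [Finset.sum_ite_eq']
    by_cases h : i + 1 < n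
    · simp [h]
    · have : i + 1 = n := by omega
      simp [this, hf]

lemma kacM_eig (n : ℕ) (z : ℂ) (u i : Fin n) :
    ∑ j : Fin n, kacM ℂ n (z ^ 2) i j * (kacPoly z (n - 1 - u) u).coeff j =
      ((((n : ℤ) - 1 - 2 * (u : ℕ) : ℤ) : ℂ) * z) * (kacPoly z (n - 1 - u) u).coeff i := by
  have hu := u.2
  have hs : n - 1 - (u : ℕ) + u = n - 1 := by omega
  have hd := kacPoly_natDegree z (n - 1 - u) u
  have ho := kacPoly_ode z (n - 1 - u) u
  have hc : (((n - 1 - (u : ℕ) : ℕ) : ℂ)) = (n : ℂ) - 1 - (u : ℕ) := by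
    rw [Nat.sub_sub, Nat.cast_sub (by omega)]; push_cast; ring
  have hc2 : ((n - 1 : ℕ) : ℂ) = (n : ℂ) - 1 := by
    rw [Nat.cast_sub (by omega)]; simp
  rw [hs, hc, hc2] at ho
  rw [hs] at hd
  generalize kacPoly z (n - 1 - u) u = p at *
  rw [kacM_sum n (z ^ 2) (fun k => p.coeff k)
    (Polynomial.coeff_eq_zero_of_natDegree_lt (by omega)) i]
  have hi := congrArg (fun q => Polynomial.coeff q (i : ℕ)) ho
  simp only [Polynomial.coeff_add, Polynomial.coeff_C_mul, Polynomial.coeff_sub] at hi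
  push_cast
  rcases i with ⟨i, hin⟩
  rcases i with _ | _ | m
  · simp [Polynomial.coeff_derivative] at hi ⊢
    linear_combination hi
  · simp [Polynomial.coeff_derivative, Polynomial.coeff_X_mul] at hi ⊢
    linear_combination hi
  · simp [Polynomial.coeff_derivative, Polynomial.coeff_X_mul] at hi ⊢
    linear_combination hi

lemma kac2M_apply (n1 n2 : ℕ) (x y : ℂ) (p q : Fin n1 × Fin n2) :
    kac2M ℂ n1 n2 x y p q = (if p.1 = q.1 then kacM ℂ n2 y p.2 q.2 else 0)
      + (if p.2 = q.2 then kacM ℂ n1 x p.1 q.1 else 0) := by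
  simp only [kac2M, Matrix.of_apply]
  by_cases h : p.1 = q.1
  · simp [h, kacM]
  · by_cases h2 : p.2 = q.2
    · simp [h, h2, kacM]
    · simp [h, h2]

lemma kac2M_eig (n1 n2 : ℕ) (z1 z2 : ℂ) (u : Fin n1 × Fin n2) :
    kac2M ℂ n1 n2 (z1 ^ 2) (z2 ^ 2) *ᵥ (fun q => (kacPoly z1 (n1 - 1 - u.1) u.1).coeff q.1 *
        (kacPoly z2 (n2 - 1 - u.2) u.2).coeff q.2) =
      ((((n1 : ℤ) - 1 - 2 * (u.1 : ℕ) : ℤ) : ℂ) * z1 +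
              (((n2 : ℤ) - 1 - 2 * (u.2 : ℕ) : ℤ) : ℂ) * z2) •
        (fun q => (kacPoly z1 (n1 - 1 - u.1) u.1).coeff q.1 *
        (kacPoly z2 (n2 - 1 - u.2) u.2).coeff q.2) := by
  ext ⟨i, j⟩
  have e1 := kacM_eig n1 z1 u.1 i
  have e2 := kacM_eig n2 z2 u.2 j
  simp only [Matrix.mulVec, dotProduct, kac2M_apply, add_mul, Finset.sum_add_distrib,
    Pi.smul_apply, smul_eq_mul, Fintype.sum_prod_type, ite_mul, zero_mul]
  rw [Finset.sum_comm]
  simp only [Finset.sum_ite_eq, Finset.mem_univ, if_true]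
  rw [mul_left_comm ((((n2 : ℤ) - 1 - 2 * (u.2 : ℕ) : ℤ) : ℂ) * z2), ← e2, ← mul_assoc, ← e1,
    Finset.mul_sum, Finset.sum_mul, add_comm]
  congr 1
  · exact Finset.sum_congr rfl fun _ _ => by ring
  · exact Finset.sum_congr rfl fun _ _ => by ring

/-- If `x ≠ y` are real, `z1² = x`, `z2² = y` and `(z1,z2)` is
`(n1,n2)`-independent, then the characteristic polynomial of `K(n1,n2,x,y)` over `ℂ`
is `∏_{u,v} (X - λ_{uv})` with `λ_{uv} = (n1-1-2u)z1 + (n2-1-2v)z2`, and the `λ_{uv}`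
are pairwise distinct; in particular `K(n1,n2,x,y)` has exactly `n1·n2` simple
eigenvalues. -/
theorem kac2_charpoly_and_simple_eigenvalues (n1 n2 : ℕ) (h1 : 2 ≤ n1) (h2 : 2 ≤ n2)
    (x y : ℝ) (hxy : x ≠ y) (z1 z2 : ℂ) (hz1 : z1 ^ 2 = (x : ℂ)) (hz2 : z2 ^ 2 = (y : ℂ))
    (hind : IndepPair n1 n2 z1 z2) :
    (kac2M ℂ n1 n2 (x : ℂ) (y : ℂ)).charpoly =
        ∏ p : Fin n1 × Fin n2,
          (Polynomial.X - Polynomial.C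
            ((((n1 : ℤ) - 1 - 2 * (p.1 : ℕ) : ℤ) : ℂ) * z1 +
              (((n2 : ℤ) - 1 - 2 * (p.2 : ℕ) : ℤ) : ℂ) * z2)) ∧
      Function.Injective (fun p : Fin n1 × Fin n2 =>
        (((n1 : ℤ) - 1 - 2 * (p.1 : ℕ) : ℤ) : ℂ) * z1 +
          (((n2 : ℤ) - 1 - 2 * (p.2 : ℕ) : ℤ) : ℂ) * z2) := by
  have hinj : Function.Injective (fun p : Fin n1 × Fin n2 =>
        (((n1 : ℤ) - 1 - 2 * (p.1 : ℕ) : ℤ) : ℂ) * z1 +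
          (((n2 : ℤ) - 1 - 2 * (p.2 : ℕ) : ℤ) : ℂ) * z2) := by
    rintro p q h
    have := hind ((n1 : ℤ) - 1 - 2 * (p.1 : ℕ)) ((n1 : ℤ) - 1 - 2 * (q.1 : ℕ))
      ((n2 : ℤ) - 1 - 2 * (p.2 : ℕ)) ((n2 : ℤ) - 1 - 2 * (q.2 : ℕ))
      ⟨_, p.1.2, rfl⟩ ⟨_, q.1.2, rfl⟩ ⟨_, p.2.2, rfl⟩ ⟨_, q.2.2, rfl⟩ (by
        push_cast at h ⊢
        linear_combination h)
    apply Prod.ext <;> apply Fin.ext <;> omega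
  refine ⟨?_, hinj⟩
  rw [← hz1, ← hz2]
  symm
  apply Polynomial.eq_of_dvd_of_natDegree_le_of_leadingCoeff
  · apply Finset.prod_dvd_of_coprime
    · intro p _ q _ hpq
      exact Polynomial.pairwise_coprime_X_sub_C hinj hpq
    · intro u _
      rw [Polynomial.dvd_iff_isRoot, ← Matrix.mem_spectrum_iff_isRoot_charpoly,
        ← Matrix.spectrum_toLin', ← Module.End.hasEigenvalue_iff_mem_spectrum]
      refine Module.End.hasEigenvalue_of_hasEigenvector
        (x := fun q => (kacPoly z1 (n1 - 1 - u.1) u.1).coeff q.1 *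
          (kacPoly z2 (n2 - 1 - u.2) u.2).coeff q.2) ⟨?_, ?_⟩
      · rw [Module.End.mem_eigenspace_iff, Matrix.toLin'_apply]
        exact kac2M_eig n1 n2 z1 z2 u
      · intro h
        have := congrFun h (⟨0, by omega⟩, ⟨0, by omega⟩)
        simp [kacPoly_coeff_zero] at this
  · rw [Matrix.charpoly_natDegree_eq_dim, Polynomial.natDegree_prod_of_monic _ _
      (fun p _ => Polynomial.monic_X_sub_C _)]
    simp only [Polynomial.natDegree_X_sub_C]
    simp
  · rw [(Matrix.charpoly_monic _).leadingCoeff,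
      (Polynomial.monic_prod_of_monic _ _ (fun p _ => Polynomial.monic_X_sub_C _)).leadingCoeff]
end
end

section
/- For all integers n1, n2 ≥ 1, all real numbers x, y, and every integer m ≥ 0, K(n1,n2,x,y)^m = Σ_{j=0}^{m} binom(m,j) · 𝒦(n1,x)^j ⊗ 𝒦(n2,y)^{m−j}, where ⊗ denotes the Kronecker product. -/
open Matrix Kronecker

noncomputable section

theorem kac2M_eq_add (n1 n2 : ℕ) (x y : ℝ) :
    kac2M ℝ n1 n2 x y =
      kacM ℝ n1 x ⊗ₖ (1 : Matrix (Fin n2) (Fin n2) ℝ) +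
        (1 : Matrix (Fin n1) (Fin n1) ℝ) ⊗ₖ kacM ℝ n2 y := by
  ext ⟨a, b⟩ ⟨c, d⟩
  simp only [kac2M, Matrix.of_apply, Matrix.add_apply, Matrix.kronecker_apply, Matrix.one_apply]
  by_cases hac : a = c
  · subst hac
    simp [kacM]
  · by_cases hbd : b = d <;> simp [hac, hbd, kacM]

theorem kron_pow_aux {k l : ℕ} (A : Matrix (Fin k) (Fin k) ℝ) (B : Matrix (Fin l) (Fin l) ℝ)
    (j : ℕ) : (A ⊗ₖ B) ^ j = (A ^ j) ⊗ₖ (B ^ j) := by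
  induction j with
  | zero => simp
  | succ j ih => rw [pow_succ, pow_succ, pow_succ, ih, Matrix.mul_kronecker_mul]

/-- For all `n1, n2 ≥ 1`, real `x, y` and `m ≥ 0`,
`K(n1,n2,x,y)^m = Σ_{j=0}^m binom(m,j) · 𝒦(n1,x)^j ⊗ 𝒦(n2,y)^{m-j}`. -/
theorem kac2_pow_binomial (n1 n2 : ℕ) (h1 : 1 ≤ n1) (h2 : 1 ≤ n2) (x y : ℝ) (m : ℕ) :
    kac2M ℝ n1 n2 x y ^ m =
      ∑ j ∈ Finset.range (m + 1),
        m.choose j • ((kacM ℝ n1 x ^ j) ⊗ₖ (kacM ℝ n2 y ^ (m - j))) := by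
  rw [kac2M_eq_add]
  have hc : Commute (kacM ℝ n1 x ⊗ₖ (1 : Matrix (Fin n2) (Fin n2) ℝ))
      ((1 : Matrix (Fin n1) (Fin n1) ℝ) ⊗ₖ kacM ℝ n2 y) := by
    simp only [Commute, SemiconjBy, ← Matrix.mul_kronecker_mul, one_mul, mul_one]
  rw [hc.add_pow]
  refine Finset.sum_congr rfl fun j _ => ?_
  rw [kron_pow_aux, kron_pow_aux, ← Matrix.mul_kronecker_mul, one_pow, one_pow, one_mul, mul_one,
    nsmul_eq_mul]
  exact (Nat.cast_commute _ _).symm.eq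
end
end

section
/- Let n1, n2 ≥ 2 be integers, τ ∈ ℝ, and let s, c : ℝ → ℝ be differentiable functions satisfying s' = c and c' = τ·s. Let α = (α_{u,v}) be real numbers indexed by 0 ≤ u ≤ n1, 0 ≤ v ≤ n2−1, and define F(r) = Σ_{u,v} α_{u,v} · r^u · c(r)^{n2−1−v} s(r)^v. Then F'(r) = Σ_{u,v} α'_{u,v} · r^u · c(r)^{n2−1−v} s(r)^v for all r ∈ ℝ, where, regarding α as a column vector in ℝ^{(n1+1)n2} with the index (u,v) placed at position u·n2 + v + 1, the new coefficient vector is α' = K(n1+1,n2,0,τ)·α. -/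
open Matrix Kronecker

noncomputable section

theorem sum_down (n j : ℕ) (hj : j < n) (f : ℕ → ℝ) :
    ∑ u : Fin n, (if j = (u : ℕ) + 1 then (((u : ℕ) + 1 : ℕ) : ℝ) else 0) * f u
      = (j : ℝ) * f (j - 1) := by
  rw [Fin.sum_univ_eq_sum_range
    (fun u => (if j = u + 1 then ((u + 1 : ℕ) : ℝ) else 0) * f u) n]
  rcases j with _ | k
  · simp
  · rw [Finset.sum_eq_single k]
    · simp
    · intro b _ hb
      rw [if_neg (by omega), zero_mul]
    · intro h
      exact absurd (Finset.mem_range.2 (by omega)) h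

theorem sum_up (n j : ℕ) (hj : j < n) (y : ℝ) (f : ℕ → ℝ) :
    ∑ u : Fin n, (if (u : ℕ) = j + 1 then ((n - 1 - j : ℕ) : ℝ) * y else 0) * f u
      = ((n - 1 - j : ℕ) : ℝ) * y * f (j + 1) := by
  rw [Fin.sum_univ_eq_sum_range
    (fun u => (if u = j + 1 then ((n - 1 - j : ℕ) : ℝ) * y else 0) * f u) n]
  rw [Finset.sum_eq_single (j + 1)]
  · simp
  · intro b _ hb
    rw [if_neg hb, zero_mul]
  · intro h
    have : n - 1 - j = 0 := by
      rw [Finset.mem_range] at h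
      omega
    simp [this]

theorem sum_kac (n : ℕ) (y C S : ℝ) (j : Fin n) :
    ∑ i : Fin n, kacM ℝ n y i j * (C ^ (n - 1 - (i : ℕ)) * S ^ (i : ℕ))
      = ((n - 1 - (j : ℕ) : ℕ) : ℝ) * C ^ (n - 1 - (j : ℕ) - 1) * (y * S) * S ^ (j : ℕ)
        + C ^ (n - 1 - (j : ℕ)) * ((j : ℕ) * S ^ ((j : ℕ) - 1) * C) := by
  have hK : ∀ i : Fin n, kacM ℝ n y i j
      = (if (i : ℕ) = (j : ℕ) + 1 then ((n - 1 - (j : ℕ) : ℕ) : ℝ) * y else 0)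
        + (if (j : ℕ) = (i : ℕ) + 1 then (((i : ℕ) + 1 : ℕ) : ℝ) else 0) := by
    intro i
    simp only [kacM, Matrix.of_apply]
    split_ifs <;> first | omega | simp
  simp only [hK, add_mul, Finset.sum_add_distrib]
  rw [sum_up n j j.2 y (fun i => C ^ (n - 1 - i) * S ^ i),
    sum_down n j j.2 (fun i => C ^ (n - 1 - i) * S ^ i)]
  congr 1
  · rw [Nat.sub_add_eq, pow_succ]
    ring
  · obtain ⟨j, hj⟩ := j
    rcases j with _ | k
    · simp
    · have : n - 1 - k = (n - 1 - (k + 1)) + 1 := by omega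
      simp only [Nat.add_sub_cancel]
      rw [this, pow_succ]
      ring

theorem sum_kac2 (n1 n2 : ℕ) (y r C S : ℝ) (q : Fin n1 × Fin n2) :
    ∑ p : Fin n1 × Fin n2, kac2M ℝ n1 n2 0 y p q *
        (r ^ (p.1 : ℕ) * (C ^ (n2 - 1 - (p.2 : ℕ)) * S ^ (p.2 : ℕ)))
      = ((q.1 : ℕ) * r ^ ((q.1 : ℕ) - 1)) * (C ^ (n2 - 1 - (q.2 : ℕ)) * S ^ (q.2 : ℕ))
        + r ^ (q.1 : ℕ) *
        (((n2 - 1 - (q.2 : ℕ) : ℕ) : ℝ) * C ^ (n2 - 1 - (q.2 : ℕ) - 1) * (y * S) * S ^ (q.2 : ℕ)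
        + C ^ (n2 - 1 - (q.2 : ℕ)) * ((q.2 : ℕ) * S ^ ((q.2 : ℕ) - 1) * C)) := by
  obtain ⟨a, b⟩ := q
  have hK : ∀ (u : Fin n1) (v : Fin n2), kac2M ℝ n1 n2 0 y (u, v) (a, b) *
        (r ^ (u : ℕ) * (C ^ (n2 - 1 - (v : ℕ)) * S ^ (v : ℕ)))
      = ((if (a : ℕ) = (u : ℕ) + 1 then (((u : ℕ) + 1 : ℕ) : ℝ) else 0) * r ^ (u : ℕ)) *
          (if v = b then C ^ (n2 - 1 - (v : ℕ)) * S ^ (v : ℕ) else 0)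
        + (if u = a then r ^ (u : ℕ) else 0) *
          (kacM ℝ n2 y v b * (C ^ (n2 - 1 - (v : ℕ)) * S ^ (v : ℕ))) := by
    intro u v
    simp only [kac2M, Matrix.of_apply]
    by_cases h : u = a
    · subst h
      simp
      ring
    · by_cases h' : v = b
      · simp [h, h']
        split_ifs <;> first | omega | ring
      · simp [h, h']
  simp only [Fintype.sum_prod_type, hK, Finset.sum_add_distrib, ← Finset.mul_sum,
    ← Finset.sum_mul]
  rw [sum_kac, sum_down n1 a a.2 (fun u => r ^ u)]
  simp

/-- If `s' = c`, `c' = τ·s` and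
`F(r) = Σ_{u,v} α_{u,v}·r^u·c(r)^{n2-1-v} s(r)^v` (`0 ≤ u ≤ n1`, `0 ≤ v ≤ n2-1`), then
`F'(r) = Σ_{u,v} α'_{u,v}·r^u·c(r)^{n2-1-v} s(r)^v` where, viewing `α` as a vector in
`ℝ^{(n1+1)n2}` with `(u,v)` at position `u·n2+v+1`, `α' = K(n1+1,n2,0,τ)·α`. -/
theorem deriv_parallel_family_flat (n1 n2 : ℕ) (h1 : 2 ≤ n1) (h2 : 2 ≤ n2) (τ : ℝ)
    (s c : ℝ → ℝ)
    (hs : ∀ r, HasDerivAt s (c r) r) (hc : ∀ r, HasDerivAt c (τ * s r) r)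
    (α : Fin (n1 + 1) × Fin n2 → ℝ) (r : ℝ) :
    HasDerivAt (fun r => ∑ p : Fin (n1 + 1) × Fin n2,
        α p * (r ^ (p.1 : ℕ) * (c r ^ (n2 - 1 - (p.2 : ℕ)) * s r ^ (p.2 : ℕ))))
      (∑ p : Fin (n1 + 1) × Fin n2,
        (kac2M ℝ (n1 + 1) n2 0 τ).mulVec α p *
          (r ^ (p.1 : ℕ) * (c r ^ (n2 - 1 - (p.2 : ℕ)) * s r ^ (p.2 : ℕ)))) r := by
  have hF : HasDerivAt (fun r => ∑ p : Fin (n1 + 1) × Fin n2,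
        α p * (r ^ (p.1 : ℕ) * (c r ^ (n2 - 1 - (p.2 : ℕ)) * s r ^ (p.2 : ℕ)))) _ r :=
    HasDerivAt.fun_sum fun p _ => ((hasDerivAt_pow (p.1 : ℕ) r).fun_mul
      (((hc r).fun_pow (n2 - 1 - (p.2 : ℕ))).fun_mul
        ((hs r).fun_pow (p.2 : ℕ)))).const_mul (α p)
  refine hF.congr_deriv ?_
  simp only [Matrix.mulVec, dotProduct, Finset.sum_mul]
  rw [Finset.sum_comm]
  refine Finset.sum_congr rfl fun q _ => ?_
  rw [← sum_kac2 (n1 + 1) n2 τ r (c r) (s r) q, Finset.mul_sum]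
  refine Finset.sum_congr rfl fun p _ => ?_
  ring
end
end

section
/- Let n1, n2 ≥ 2 be integers and τ1, τ2 ∈ ℝ, and write M = M(n1,n2,τ1,τ2) = (m_{ij}). Then: (a) the family of odd-indexed rows {L_{2i−1} : i = 1,…,n1n2} of M is linearly dependent; (b) the family of columns C_j of M such that m_{(2i−1)j} = 0 for all i = 1,…,n1n2 (i.e. all odd-indexed entries of the column vanish) is linearly dependent; in particular, det M = 0, i.e. M is a singular matrix. -/
open Matrix Kronecker

noncomputable section

/-- `K(n1,n2,x,y)` as a matrix indexed by `Fin (n1·n2)`, placing the pair `(u,v)` at the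
0-based position `u·n2 + v`. -/
def kac2Fin (n1 n2 : ℕ) (x y : ℝ) : Matrix (Fin (n1 * n2)) (Fin (n1 * n2)) ℝ :=
  Matrix.reindex finProdFinEquiv finProdFinEquiv (kac2M ℝ n1 n2 x y)

/-- The matrix `Q(n1,n2,τ1,τ2) = [[K, I],[0, K]]` (blocks of order `n1·n2`),
where `K = K(n1,n2,τ1,τ2)`, indexed by `Fin (2·n1·n2)`. -/
def Qmat (n1 n2 : ℕ) (τ1 τ2 : ℝ) :
    Matrix (Fin (2 * (n1 * n2))) (Fin (2 * (n1 * n2))) ℝ :=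
  Matrix.reindex (finSumFinEquiv.trans (finCongr (two_mul (n1 * n2)).symm))
    (finSumFinEquiv.trans (finCongr (two_mul (n1 * n2)).symm))
    (Matrix.fromBlocks (kac2Fin n1 n2 τ1 τ2) 1 0 (kac2Fin n1 n2 τ1 τ2))

/-- The first standard basis row vector `e1 = (1,0,…,0)` of `ℝ^n`. -/
def e1v (n : ℕ) : Fin n → ℝ := fun i => if (i : ℕ) = 0 then 1 else 0

/-- The `(2n1n2-1) × (2n1n2)` matrix `M̄(n1,n2,τ1,τ2)` whose `i`-th row (1-based) is
the row vector `e1·Q^{i+1}`. -/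
def Mbar (n1 n2 : ℕ) (τ1 τ2 : ℝ) :
    Matrix (Fin (2 * (n1 * n2) - 1)) (Fin (2 * (n1 * n2))) ℝ :=
  Matrix.of fun i j =>
    Matrix.vecMul (e1v (2 * (n1 * n2))) (Qmat n1 n2 τ1 τ2 ^ ((i : ℕ) + 2)) j

/-- The square matrix `M(n1,n2,τ1,τ2)` of order `2n1n2-1` obtained from `M̄` by deleting
its first column. -/
def Mmat (n1 n2 : ℕ) (τ1 τ2 : ℝ) :
    Matrix (Fin (2 * (n1 * n2) - 1)) (Fin (2 * (n1 * n2) - 1)) ℝ :=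
  Matrix.of fun i j =>
    Mbar n1 n2 τ1 τ2 i ⟨(j : ℕ) + 1, by have := j.isLt; omega⟩


/-- Bipartite colouring of the index set of the block matrix. -/
def colS (n1 n2 : ℕ) : (Fin n1 × Fin n2) ⊕ (Fin n1 × Fin n2) → ZMod 2
  | Sum.inl p => ((p.1 : ℕ) : ZMod 2) + ((p.2 : ℕ) : ZMod 2)
  | Sum.inr p => ((p.1 : ℕ) : ZMod 2) + ((p.2 : ℕ) : ZMod 2) + 1

/-- Identification of the block index set with `Fin (2 n1 n2)`. -/
def eqS (n1 n2 : ℕ) : (Fin n1 × Fin n2) ⊕ (Fin n1 × Fin n2) ≃ Fin (2 * (n1 * n2)) :=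
  (Equiv.sumCongr finProdFinEquiv finProdFinEquiv).trans
    (finSumFinEquiv.trans (finCongr (two_mul (n1 * n2)).symm))

lemma zmod2_flip (a : ZMod 2) : a + 1 + 1 = a := by
  revert a; decide

lemma kacM_bip (n : ℕ) (y : ℝ) (p q : Fin n) (h : kacM ℝ n y p q ≠ 0) :
    ((q : ℕ) : ZMod 2) = ((p : ℕ) : ZMod 2) + 1 := by
  unfold kacM at h
  simp only [Matrix.of_apply] at h
  split_ifs at h with h1 h2
  · rw [h1]; push_cast; rw [zmod2_flip]
  · rw [h2]; push_cast; rfl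
  · exact absurd rfl h

lemma kac2M_bip (n1 n2 : ℕ) (x y : ℝ) (p q : Fin n1 × Fin n2)
    (h : kac2M ℝ n1 n2 x y p q ≠ 0) :
    ((q.1 : ℕ) : ZMod 2) + ((q.2 : ℕ) : ZMod 2)
      = ((p.1 : ℕ) : ZMod 2) + ((p.2 : ℕ) : ZMod 2) + 1 := by
  unfold kac2M at h
  simp only [Matrix.of_apply] at h
  split_ifs at h with h1 h2 h3 h4 h5
  · rw [kacM_bip _ _ _ _ h, h1]; ring
  · rw [h2, h3]; push_cast
    rw [add_right_comm, zmod2_flip]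
  · exact absurd rfl h
  · rw [h4, h5]; push_cast; ring
  · exact absurd rfl h
  · exact absurd rfl h

lemma Qmat_bip (n1 n2 : ℕ) (x y : ℝ) (a b : (Fin n1 × Fin n2) ⊕ (Fin n1 × Fin n2))
    (h : Qmat n1 n2 x y (eqS n1 n2 a) (eqS n1 n2 b) ≠ 0) :
    colS n1 n2 b = colS n1 n2 a + 1 := by
  unfold Qmat eqS kac2Fin at h
  rcases a with p | p <;> rcases b with q | q <;>
    simp only [Matrix.reindex_apply, Matrix.submatrix_apply, Equiv.trans_apply,
      Equiv.symm_trans_apply, Equiv.symm_apply_apply, Equiv.sumCongr_apply, Sum.map_inl,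
      Sum.map_inr, Matrix.fromBlocks_apply₁₁, Matrix.fromBlocks_apply₁₂,
      Matrix.fromBlocks_apply₂₁, Matrix.fromBlocks_apply₂₂] at h
  · exact kac2M_bip _ _ _ _ _ _ h
  · have : p = q := by
      by_contra hne
      apply h
      rw [Matrix.one_apply_ne]
      exact fun hh => hne (finProdFinEquiv.injective hh)
    subst this; rfl
  · exact absurd rfl h
  · simp only [colS]; rw [kac2M_bip _ _ _ _ _ _ h]

lemma Qpow_bip (n1 n2 : ℕ) (x y : ℝ) (k : ℕ) (i j : Fin (2 * (n1 * n2)))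
    (h : (Qmat n1 n2 x y ^ k) i j ≠ 0) :
    colS n1 n2 ((eqS n1 n2).symm j) = colS n1 n2 ((eqS n1 n2).symm i) + k := by
  induction k generalizing j with
  | zero =>
    have : i = j := by
      by_contra hne
      exact h (by rw [pow_zero, Matrix.one_apply_ne hne])
    subst this; simp
  | succ k ih =>
    rw [pow_succ, Matrix.mul_apply] at h
    obtain ⟨l, -, hl⟩ := Finset.exists_ne_zero_of_sum_ne_zero h
    have h1 := ih l (left_ne_zero_of_mul hl)
    have h2 : Qmat n1 n2 x y (eqS n1 n2 ((eqS n1 n2).symm l))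
        (eqS n1 n2 ((eqS n1 n2).symm j)) ≠ 0 := by
      simpa using right_ne_zero_of_mul hl
    rw [Qmat_bip _ _ _ _ _ _ h2, h1]; push_cast; ring

/-- Colour of the columns of `M`. -/
def colM (n1 n2 : ℕ) (j : Fin (2 * (n1 * n2) - 1)) : ZMod 2 :=
  colS n1 n2 ((eqS n1 n2).symm ⟨(j : ℕ) + 1, by have := j.isLt; omega⟩)

lemma colS_zero (n1 n2 : ℕ) (i : Fin (2 * (n1 * n2))) (hi : (i : ℕ) = 0) :
    colS n1 n2 ((eqS n1 n2).symm i) = 0 := by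
  have hpos : 0 < n1 * n2 := by have := i.isLt; omega
  have a1 : 0 < n1 := Nat.pos_of_mul_pos_right hpos
  have a2 : 0 < n2 := Nat.pos_of_mul_pos_left hpos
  have : i = eqS n1 n2 (Sum.inl (⟨0, a1⟩, ⟨0, a2⟩)) := by
    apply Fin.ext
    simp [eqS, hi, finProdFinEquiv]
  rw [this, Equiv.symm_apply_apply]
  simp [colS]

lemma Mmat_bip (n1 n2 : ℕ) (x y : ℝ) (i j : Fin (2 * (n1 * n2) - 1))
    (h : Mmat n1 n2 x y i j ≠ 0) : colM n1 n2 j = ((i : ℕ) : ZMod 2) := by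
  unfold Mmat Mbar at h
  simp only [Matrix.of_apply, Matrix.vecMul, dotProduct] at h
  obtain ⟨l, -, hl⟩ := Finset.exists_ne_zero_of_sum_ne_zero h
  have h0 : (l : ℕ) = 0 := by
    by_contra hne
    exact left_ne_zero_of_mul hl (by simp [e1v, hne])
  have := Qpow_bip _ _ _ _ _ _ _ (right_ne_zero_of_mul hl)
  rw [colS_zero _ _ _ h0] at this
  unfold colM
  rw [this]; push_cast
  have key : ∀ a : ZMod 2, 0 + (a + 2) = a := by decide
  exact key _

lemma card_le_of_support {κ ι : Type*} [Fintype κ] [Fintype ι] (P : ι → Prop) [DecidablePred P]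
    (v : κ → ι → ℝ) (hv : ∀ k i, ¬ P i → v k i = 0) (hli : LinearIndependent ℝ v) :
    Fintype.card κ ≤ Fintype.card {i // P i} := by
  have : LinearIndependent ℝ (fun k => fun i : {i // P i} => v k i.1) := by
    rw [Fintype.linearIndependent_iff] at hli ⊢
    intro g hg
    apply hli g
    funext i
    by_cases hi : P i
    · have := congrFun hg ⟨i, hi⟩
      simpa [Finset.sum_apply] using this
    · simp [Finset.sum_apply, hv _ _ hi]
  simpa using this.fintype_card_le_finrank

lemma card_col_one (n1 n2 : ℕ) :
    n1 * n2 ≤ Fintype.card {j : Fin (2 * (n1 * n2) - 1) // colM n1 n2 j = 1} := by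
  let s : Fin n1 × Fin n2 → (Fin n1 × Fin n2) ⊕ (Fin n1 × Fin n2) := fun p =>
    if colS n1 n2 (Sum.inl p) = 1 then Sum.inl p else Sum.inr p
  have hs : ∀ p, colS n1 n2 (s p) = 1 := by
    intro p
    by_cases h : colS n1 n2 (Sum.inl p) = 1
    · simp only [s, if_pos h]; exact h
    · simp only [s, if_neg h]
      have key : ∀ a : ZMod 2, a ≠ 1 → a + 1 = 1 := by decide
      exact key _ h
  have hinj : Function.Injective s := by
    intro p q h
    simp only [s] at h
    split_ifs at h <;> simpa using h
  have hne : ∀ p, ((eqS n1 n2 (s p) : Fin _) : ℕ) ≠ 0 := by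
    intro p h0
    have := colS_zero _ _ _ h0
    rw [Equiv.symm_apply_apply, hs] at this
    exact absurd this (by decide)
  let f : Fin n1 × Fin n2 → {j : Fin (2 * (n1 * n2) - 1) // colM n1 n2 j = 1} := fun p =>
    ⟨⟨(eqS n1 n2 (s p) : ℕ) - 1, by have := (eqS n1 n2 (s p)).isLt; have := hne p; omega⟩, by
      unfold colM
      have : (⟨(eqS n1 n2 (s p) : ℕ) - 1 + 1, by
          have := (eqS n1 n2 (s p)).isLt; have := hne p; omega⟩ : Fin (2 * (n1 * n2)))
          = eqS n1 n2 (s p) := by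
        apply Fin.ext; have := hne p; simp only; omega
      simp only [this, Equiv.symm_apply_apply, hs]⟩
  have hf : Function.Injective f := by
    intro p q h
    apply hinj
    apply (eqS n1 n2).injective
    apply Fin.ext
    have h' : (eqS n1 n2 (s p) : ℕ) - 1 = (eqS n1 n2 (s q) : ℕ) - 1 :=
      congrArg (fun z => (z.1 : ℕ)) h
    have := hne p; have := hne q; omega
  have := Fintype.card_le_of_injective f hf
  simpa using this

lemma card_row_even (N : ℕ) :
    N ≤ Fintype.card {i : Fin (2 * N - 1) // (i : ℕ) % 2 = 0} := by
  let f : Fin N → {i : Fin (2 * N - 1) // (i : ℕ) % 2 = 0} := fun k =>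
    ⟨⟨2 * k, by have := k.isLt; omega⟩, by simp⟩
  have hf : Function.Injective f := by
    intro p q h
    have h' : 2 * (p : ℕ) = 2 * (q : ℕ) := congrArg (fun z => (z.1 : ℕ)) h
    apply Fin.ext; omega
  simpa using Fintype.card_le_of_injective f hf

/-- For `M = M(n1,n2,τ1,τ2) = (m_{ij})`: (a) the family of odd-indexed
rows `L_{2i-1}`, `i = 1,…,n1n2`, of `M` is linearly dependent; (b) the family of columns
of `M` all of whose odd-indexed entries vanish is linearly dependent; in particular
`det M = 0`. (Indices of rows/columns are 1-based in the informal statement; 0-based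
index `k` corresponds to 1-based index `k+1`, so "odd-indexed" means `k % 2 = 0`.) -/
theorem Mmat_singular (n1 n2 : ℕ) (h1 : 2 ≤ n1) (h2 : 2 ≤ n2) (τ1 τ2 : ℝ) :
    (¬ LinearIndependent ℝ
        (fun i : {i : Fin (2 * (n1 * n2) - 1) // (i : ℕ) % 2 = 0} =>
          Mmat n1 n2 τ1 τ2 i.1)) ∧
      (¬ LinearIndependent ℝ
        (fun j : {j : Fin (2 * (n1 * n2) - 1) //
            ∀ i : Fin (2 * (n1 * n2) - 1), (i : ℕ) % 2 = 0 → Mmat n1 n2 τ1 τ2 i j = 0} =>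
          fun i => Mmat n1 n2 τ1 τ2 i j.1)) ∧
      (Mmat n1 n2 τ1 τ2).det = 0 := by
  have hpos : 0 < n1 * n2 := Nat.mul_pos (by omega) (by omega)
  have hA : ¬ LinearIndependent ℝ
        (fun i : {i : Fin (2 * (n1 * n2) - 1) // (i : ℕ) % 2 = 0} =>
          Mmat n1 n2 τ1 τ2 i.1) := by
    intro hli
    have h := card_le_of_support (fun j => ¬ colM n1 n2 j = 1) _ (by
      intro k j hj
      rw [not_not] at hj
      by_contra hne
      have := Mmat_bip _ _ _ _ _ _ hne
      have h0 : (((k.1 : Fin _) : ℕ) : ZMod 2) = 0 := by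
        rw [ZMod.natCast_eq_zero_iff]; exact Nat.dvd_of_mod_eq_zero k.2
      rw [hj, h0] at this
      exact absurd this (by decide)) hli
    have h3 := card_row_even (n1 * n2)
    have h4 := card_col_one n1 n2
    rw [Fintype.card_subtype_compl, Fintype.card_fin] at h
    omega
  refine ⟨hA, ?_, ?_⟩
  · intro hli
    classical
    have h := card_le_of_support (fun i : Fin (2 * (n1 * n2) - 1) => ¬ (i : ℕ) % 2 = 0) _ (by
      intro k i hi
      rw [not_not] at hi
      exact k.2 i hi) hli
    have h3 := card_row_even (n1 * n2)
    have h4 := card_col_one n1 n2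
    rw [Fintype.card_subtype_compl, Fintype.card_fin] at h
    have h5 : Fintype.card {j : Fin (2 * (n1 * n2) - 1) // colM n1 n2 j = 1} ≤
        Fintype.card {j : Fin (2 * (n1 * n2) - 1) //
            ∀ i : Fin (2 * (n1 * n2) - 1), (i : ℕ) % 2 = 0 → Mmat n1 n2 τ1 τ2 i j = 0} := by
      apply Fintype.card_subtype_mono
      intro j hj i hi
      by_contra hne
      have := Mmat_bip _ _ _ _ _ _ hne
      have h0 : ((i : ℕ) : ZMod 2) = 0 := by
        rw [ZMod.natCast_eq_zero_iff]; exact Nat.dvd_of_mod_eq_zero hi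
      rw [hj, h0] at this
      exact absurd this (by decide)
    omega
  · by_contra hdet
    exact hA ((Matrix.linearIndependent_rows_of_det_ne_zero hdet).comp Subtype.val
      Subtype.val_injective)
end
end

section
/- Let n1, n2 ≥ 2 be integers with n1·n2 odd, and let τ1, τ2 ∈ ℝ be such that there exist z1, z2 ∈ ℂ with z1² = τ1, z2² = τ2 and the pair (z1,z2) (n1,n2)-independent. Set Q = Q(n1,n2,τ1,τ2). Then the family of row vectors Λ = {e1·Q^2, e1·Q^3, …, e1·Q^{2n1n2−1}} in ℝ^{2n1n2} is linearly independent, whereas for every integer s ≥ 2n1n2 the family Λ ∪ {e1·Q^s} is linearly dependent. -/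
open Matrix Kronecker

noncomputable section

open Polynomial in
theorem kac_eig (n : ℕ) (y : ℝ) (z : ℂ) (hz : z ^ 2 = (y : ℂ)) (r : ℕ) (hr : r < n) :
    ∃ u : ℕ → ℂ, u 0 = 1 ∧ ∀ i : Fin n,
      ∑ j : Fin n, ((kacM ℝ n y i j : ℝ) : ℂ) * u j
        = (((n : ℤ) - 1 - 2 * r : ℤ) : ℂ) * z * u i := by
  obtain ⟨a, ha⟩ : ∃ a, n = a + r + 1 := ⟨n - 1 - r, by omega⟩
  set P : ℂ[X] := (1 + C z * X) ^ a * (1 - C z * X) ^ r with hP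
  have hode : (1 - C (z ^ 2) * X ^ 2) * derivative P
      = (C (((a : ℂ) - r) * z) - C (((a : ℂ) + r) * z ^ 2) * X) * P := by
    have hA : (1 + C z * X) * derivative ((1 + C z * X) ^ a)
        = C ((a : ℂ) * z) * (1 + C z * X) ^ a := by
      rcases a with _ | a
      · simp
      · rw [derivative_pow_succ]; simp; ring
    have hB : (1 - C z * X) * derivative ((1 - C z * X) ^ r)
        = - C ((r : ℂ) * z) * (1 - C z * X) ^ r := by
      rcases r with _ | r
      · simp
      · rw [derivative_pow_succ]; simp; ring
    have h3 : (1 - C (z ^ 2) * X ^ 2) * derivative P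
       = (1 - C z * X) * (1 - C z * X) ^ r *
            ((1 + C z * X) * derivative ((1 + C z * X) ^ a))
         + (1 + C z * X) * (1 + C z * X) ^ a *
            ((1 - C z * X) * derivative ((1 - C z * X) ^ r)) := by
      rw [hP, derivative_mul]; simp only [C_pow]; ring
    rw [h3, hA, hB, hP]
    simp only [C_pow, C_mul, C_sub, C_add]
    ring
  have hdeg : P.natDegree ≤ a + r := by
    rw [hP]
    refine natDegree_mul_le.trans (add_le_add ?_ ?_)
    · refine natDegree_pow_le.trans ?_
      have : (1 + C z * X).natDegree ≤ 1 := by compute_degree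
      nlinarith
    · refine natDegree_pow_le.trans ?_
      have : (1 - C z * X).natDegree ≤ 1 := by compute_degree
      nlinarith
  have hn0 : P.coeff n = 0 := coeff_eq_zero_of_natDegree_lt (by omega)
  refine ⟨fun i => P.coeff i, ?_, ?_⟩
  · simp [hP, coeff_zero_eq_eval_zero]
  intro i
  have hsplit : ∀ j : Fin n, ((kacM ℝ n y i j : ℝ) : ℂ) * P.coeff j
      = (if (j : ℕ) + 1 = i then (((n - 1 - (j : ℕ) : ℕ) : ℂ) * y) * P.coeff j else 0)
        + (if (j : ℕ) = i + 1 then ((i : ℂ) + 1) * P.coeff (j : ℕ) else 0) := by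
    intro j
    unfold kacM
    simp only [Matrix.of_apply]
    by_cases h1 : (i : ℕ) = j + 1
    · have h2 : ¬ ((j : ℕ) = i + 1) := by omega
      rw [if_pos h1, if_pos h1.symm, if_neg h2]; push_cast; ring
    · rw [if_neg h1, if_neg (fun h : (j : ℕ) + 1 = i => h1 h.symm)]
      split_ifs <;> push_cast <;> ring
  simp only [hsplit, Finset.sum_add_distrib]
  rw [Fin.sum_univ_eq_sum_range (fun j => if j + 1 = (i : ℕ) then
      (((n - 1 - j : ℕ) : ℂ) * y) * P.coeff j else 0) n,
    Fin.sum_univ_eq_sum_range (fun j => if j = (i : ℕ) + 1 then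
      ((i : ℂ) + 1) * P.coeff j else 0) n]
  have hS2 : (∑ j ∈ Finset.range n, if j = (i : ℕ) + 1 then
      ((i : ℂ) + 1) * P.coeff j else 0) = ((i : ℂ) + 1) * P.coeff (i + 1) := by
    rw [Finset.sum_ite_eq']
    split_ifs with h
    · rfl
    · have : (i : ℕ) + 1 = n := by have := i.isLt; simp at h; omega
      rw [this, hn0, mul_zero]
  rw [hS2]
  have hc := congrArg (fun q => coeff q (i : ℕ)) hode
  simp only [sub_mul, one_mul, coeff_sub, mul_assoc, coeff_C_mul, coeff_derivative] at hc
  have hi := i.isLt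
  rcases hik : (i : ℕ) with _ | k
  · rw [hik] at hc
    simp [coeff_X_pow_mul'] at hc
    simp
    rw [hc, ha]; push_cast; ring
  · rw [hik] at hc
    have e1 : (X * P).coeff (k + 1) = P.coeff k := by rw [mul_comm, coeff_mul_X]
    rw [e1] at hc
    have e2 : (X ^ 2 * derivative P).coeff (k + 1) = (k : ℂ) * P.coeff k := by
      rcases k with _ | k
      · simp [coeff_X_pow_mul']
      · rw [show k + 1 + 1 = k + 2 from rfl, coeff_X_pow_mul, coeff_derivative]; push_cast; ring
    rw [e2] at hc
    have hS1 : (∑ j ∈ Finset.range n, if j + 1 = k + 1 then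
      (((n - 1 - j : ℕ) : ℂ) * y) * P.coeff j else 0)
       = (((n - 1 - k : ℕ) : ℂ) * y) * P.coeff k := by
      simp only [Nat.add_right_cancel_iff]
      rw [Finset.sum_ite_eq', if_pos (by simp; omega)]
    rw [hS1]
    have e3 : ((n - 1 - k : ℕ) : ℂ) = (a : ℂ) + r - k := by
      rw [show n - 1 - k = a + r - k by omega, Nat.cast_sub (by omega)]; push_cast; ring
    rw [e3, ← hz, ha]
    push_cast at hc ⊢
    linear_combination hc

theorem kac2M_split (n1 n2 : ℕ) (x y : ℝ) (p q : Fin n1 × Fin n2) :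
    kac2M ℝ n1 n2 x y p q = (if p.2 = q.2 then kacM ℝ n1 x p.1 q.1 else 0)
      + (if p.1 = q.1 then kacM ℝ n2 y p.2 q.2 else 0) := by
  unfold kac2M
  simp only [Matrix.of_apply]
  by_cases h : p.1 = q.1
  · simp [h, kacM]
  · simp only [if_neg h, kacM, Matrix.of_apply]
    split_ifs <;> simp

theorem kac2_eig (n1 n2 : ℕ) (τ1 τ2 : ℝ) (z1 z2 : ℂ)
    (hz1 : z1 ^ 2 = (τ1 : ℂ)) (hz2 : z2 ^ 2 = (τ2 : ℂ)) (r1 r2 : ℕ)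
    (hr1 : r1 < n1) (hr2 : r2 < n2) (l : ℂ)
    (hl : l = (((n1 : ℤ) - 1 - 2 * r1 : ℤ) : ℂ) * z1 + (((n2 : ℤ) - 1 - 2 * r2 : ℤ) : ℂ) * z2) :
    ∃ v : Fin (n1 * n2) → ℂ, (∀ i : Fin (n1 * n2), (i : ℕ) = 0 → v i = 1) ∧ ∀ i,
      ∑ j, ((kac2Fin n1 n2 τ1 τ2 i j : ℝ) : ℂ) * v j = l * v i := by
  obtain ⟨u, hu0, hu⟩ := kac_eig n1 τ1 z1 hz1 r1 hr1
  obtain ⟨w, hw0, hw⟩ := kac_eig n2 τ2 z2 hz2 r2 hr2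
  refine ⟨fun i => u (finProdFinEquiv.symm i).1 * w (finProdFinEquiv.symm i).2, ?_, ?_⟩
  · intro i hi
    simp [finProdFinEquiv, Fin.divNat, Fin.modNat, hi, hu0, hw0]
  · intro i
    obtain ⟨p, rfl⟩ := finProdFinEquiv.surjective i
    rw [← finProdFinEquiv.sum_comp]
    simp only [kac2Fin, Matrix.reindex_apply, Matrix.submatrix_apply, Equiv.symm_apply_apply,
      kac2M_split]
    have : ∀ q : Fin n1 × Fin n2,
      (((if p.2 = q.2 then kacM ℝ n1 τ1 p.1 q.1 else 0)
        + (if p.1 = q.1 then kacM ℝ n2 τ2 p.2 q.2 else 0) : ℝ) : ℂ) * (u q.1 * w q.2)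
      = (if p.2 = q.2 then (kacM ℝ n1 τ1 p.1 q.1 : ℂ) * u q.1 * w p.2 else 0)
        + (if p.1 = q.1 then (kacM ℝ n2 τ2 p.2 q.2 : ℂ) * w q.2 * u p.1 else 0) := by
      rintro ⟨q1, q2⟩
      push_cast
      rw [add_mul]
      congr 1
      · split_ifs with h
        · rw [h]; ring
        · simp
      · split_ifs with h
        · rw [h]; ring
        · simp
    simp only [this, Finset.sum_add_distrib, Fintype.sum_prod_type]
    simp only [Finset.sum_ite_eq, Finset.mem_univ, if_true]
    rw [← Finset.sum_mul, hu, Finset.sum_comm]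
    simp only [Finset.sum_ite_eq, Finset.mem_univ, if_true]
    rw [← Finset.sum_mul, hw, hl]
    ring

/-- Functionals detecting evaluation of a polynomial and its derivative at an eigenvalue. -/
theorem exists_functionals (n1 n2 : ℕ) (hpos : 0 < n1 * n2) (τ1 τ2 : ℝ) (l : ℂ)
    (v : Fin (n1 * n2) → ℂ) (hv0 : ∀ i : Fin (n1 * n2), (i : ℕ) = 0 → v i = 1)
    (hv : ∀ i, ∑ j, ((kac2Fin n1 n2 τ1 τ2 i j : ℝ) : ℂ) * v j = l * v i) :
    ∃ φ ψ : (Fin (2 * (n1 * n2)) → ℝ) →ₗ[ℝ] ℂ, ∀ k : ℕ,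
      φ (Matrix.vecMul (e1v (2 * (n1 * n2))) (Qmat n1 n2 τ1 τ2 ^ k)) = l ^ k ∧
      ψ (Matrix.vecMul (e1v (2 * (n1 * n2))) (Qmat n1 n2 τ1 τ2 ^ k)) = k * l ^ (k - 1) := by
  set K := kac2Fin n1 n2 τ1 τ2 with hK
  set e : Fin (n1 * n2) ⊕ Fin (n1 * n2) ≃ Fin (2 * (n1 * n2)) :=
    finSumFinEquiv.trans (finCongr (two_mul (n1 * n2)).symm) with he
  let φ : (Fin (2 * (n1 * n2)) → ℝ) →ₗ[ℝ] ℂ :=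
    ∑ i, (LinearMap.proj (R := ℝ) (φ := fun _ => ℝ) (e (Sum.inl i))).smulRight (v i)
  let ψ : (Fin (2 * (n1 * n2)) → ℝ) →ₗ[ℝ] ℂ :=
    ∑ i, (LinearMap.proj (R := ℝ) (φ := fun _ => ℝ) (e (Sum.inr i))).smulRight (v i)
  have hφ : ∀ x, φ x = ∑ i, (x (e (Sum.inl i)) : ℂ) * v i := by
    intro x; simp [φ, LinearMap.sum_apply]
  have hψ : ∀ x, ψ x = ∑ i, (x (e (Sum.inr i)) : ℂ) * v i := by
    intro x; simp [ψ, LinearMap.sum_apply]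
  have hgen : ∀ y : Fin (n1 * n2) → ℝ,
      ∑ i, ((∑ j, y j * K j i : ℝ) : ℂ) * v i = l * ∑ i, (y i : ℂ) * v i := by
    intro y
    push_cast
    simp only [Finset.sum_mul]
    rw [Finset.sum_comm, Finset.mul_sum]
    refine Finset.sum_congr rfl fun j _ => ?_
    rw [mul_left_comm, ← hv j, Finset.mul_sum]
    refine Finset.sum_congr rfl fun i _ => ?_
    ring
  have hl1 : ∀ x i, (Matrix.vecMul x (Qmat n1 n2 τ1 τ2)) (e (Sum.inl i))
      = ∑ j, x (e (Sum.inl j)) * K j i := by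
    intro x i
    simp only [Matrix.vecMul, dotProduct, Qmat, ← he, ← hK]
    rw [← e.sum_comp]
    simp
  have hl2 : ∀ x i, (Matrix.vecMul x (Qmat n1 n2 τ1 τ2)) (e (Sum.inr i))
      = x (e (Sum.inl i)) + ∑ j, x (e (Sum.inr j)) * K j i := by
    intro x i
    simp only [Matrix.vecMul, dotProduct, Qmat, ← he, ← hK]
    rw [← e.sum_comp]
    simp [Matrix.one_apply]
  have hφQ : ∀ x, φ (Matrix.vecMul x (Qmat n1 n2 τ1 τ2)) = l * φ x := by
    intro x
    rw [hφ, hφ]; simp only [hl1]; exact hgen _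
  have hψQ : ∀ x, ψ (Matrix.vecMul x (Qmat n1 n2 τ1 τ2)) = φ x + l * ψ x := by
    intro x
    rw [hφ, hψ, hψ]; simp only [hl2]
    rw [← hgen, ← Finset.sum_add_distrib]
    refine Finset.sum_congr rfl fun i _ => ?_
    push_cast; ring
  refine ⟨φ, ψ, fun k => ?_⟩
  induction k with
  | zero =>
    simp only [pow_zero, Matrix.vecMul_one, Nat.cast_zero, zero_mul]
    constructor
    · rw [hφ, Finset.sum_eq_single ⟨0, hpos⟩]
      · rw [hv0 _ rfl]; simp [e1v, he]
      · intro b _ hb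
        have : (b : ℕ) ≠ 0 := fun h => hb (Fin.ext h)
        simp [e1v, he]
        left; exact this
      · simp
    · rw [hψ]
      apply Finset.sum_eq_zero
      intro b _
      simp [e1v, he]
      left; intro _
      constructor <;> rintro rfl <;> simp at hpos
  | succ k ih =>
    rw [pow_succ, ← Matrix.vecMul_vecMul, hφQ, hψQ, ih.1, ih.2]
    refine ⟨by ring, ?_⟩
    rcases k with _ | k
    · simp
    · simp; ring

open Polynomial in
theorem poly_zero {ι : Type*} [Fintype ι] (l : ι → ℂ) (hl : Function.Injective l) (p : ℂ[X])
    (hdeg : p.natDegree < 2 * Fintype.card ι) (h0 : ∀ i, p.eval (l i) = 0)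
    (h1 : ∀ i, (derivative p).eval (l i) = 0) : p = 0 := by
  by_contra hp
  have hd : ∏ i, (X - C (l i)) ^ 2 ∣ p := by
    apply Finset.prod_dvd_of_coprime
    · intro i _ j _ hij
      exact (pairwise_coprime_X_sub_C hl hij).pow
    · intro i _
      rw [← le_rootMultiplicity_iff hp]
      exact (one_lt_rootMultiplicity_iff_isRoot hp).2 ⟨h0 i, h1 i⟩
  have := natDegree_le_of_dvd hd hp
  rw [natDegree_prod_of_monic _ _ (fun i _ => (monic_X_sub_C _).pow 2)] at this
  simp [natDegree_pow] at this
  omega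


/-- If `n1·n2` is odd and `τ1 = z1²`, `τ2 = z2²` with `(z1,z2)`
`(n1,n2)`-independent, then `Λ = {e1·Q^2, …, e1·Q^{2n1n2-1}}` is linearly independent,
while for every `s ≥ 2n1n2` the family `Λ ∪ {e1·Q^s}` is linearly dependent. -/
theorem rows_linearIndependent_odd (n1 n2 : ℕ) (h1 : 2 ≤ n1) (h2 : 2 ≤ n2)
    (hodd : Odd (n1 * n2)) (τ1 τ2 : ℝ) (z1 z2 : ℂ)
    (hz1 : z1 ^ 2 = (τ1 : ℂ)) (hz2 : z2 ^ 2 = (τ2 : ℂ))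
    (hind : IndepPair n1 n2 z1 z2) :
    LinearIndependent ℝ (fun k : Fin (2 * (n1 * n2) - 2) =>
        Matrix.vecMul (e1v (2 * (n1 * n2))) (Qmat n1 n2 τ1 τ2 ^ ((k : ℕ) + 2))) ∧
      ∀ s : ℕ, 2 * (n1 * n2) ≤ s →
        ¬ LinearIndependent ℝ (Sum.elim
          (fun k : Fin (2 * (n1 * n2) - 2) =>
            Matrix.vecMul (e1v (2 * (n1 * n2))) (Qmat n1 n2 τ1 τ2 ^ ((k : ℕ) + 2)))
          (fun _ : Unit =>
            Matrix.vecMul (e1v (2 * (n1 * n2))) (Qmat n1 n2 τ1 τ2 ^ s))) := by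
  classical
  have hpos : 0 < n1 * n2 := by positivity
  set w : ℕ → (Fin (2 * (n1 * n2)) → ℝ) := fun k =>
    Matrix.vecMul (e1v (2 * (n1 * n2))) (Qmat n1 n2 τ1 τ2 ^ k) with hw
  let l : Fin n1 × Fin n2 → ℂ := fun p =>
    (((n1 : ℤ) - 1 - 2 * (p.1 : ℕ) : ℤ) : ℂ) * z1 + (((n2 : ℤ) - 1 - 2 * (p.2 : ℕ) : ℤ) : ℂ) * z2
  have hfun : ∀ p, ∃ φ ψ : (Fin (2 * (n1 * n2)) → ℝ) →ₗ[ℝ] ℂ, ∀ k : ℕ,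
      φ (w k) = l p ^ k ∧ ψ (w k) = k * l p ^ (k - 1) := by
    intro p
    obtain ⟨v, hv0, hv⟩ := kac2_eig n1 n2 τ1 τ2 z1 z2 hz1 hz2 p.1 p.2 p.1.isLt p.2.isLt (l p) rfl
    exact exists_functionals n1 n2 hpos τ1 τ2 (l p) v hv0 hv
  have hinj : Function.Injective l := by
    intro p q hpq
    have := hind _ _ _ _ ⟨p.1, p.1.isLt, rfl⟩ ⟨q.1, q.1.isLt, rfl⟩ ⟨p.2, p.2.isLt, rfl⟩
      ⟨q.2, q.2.isLt, rfl⟩ (by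
        simp only [l] at hpq
        push_cast at hpq ⊢
        linear_combination hpq)
    refine Prod.ext (Fin.ext ?_) (Fin.ext ?_) <;> omega
  constructor
  · rw [Fintype.linearIndependent_iff]
    intro c hc
    let p : Polynomial ℂ := ∑ k : Fin (2 * (n1 * n2) - 2),
      Polynomial.C (c k : ℂ) * Polynomial.X ^ ((k : ℕ) + 2)
    have hp : p = 0 := by
      apply poly_zero l hinj
      · simp only [Fintype.card_prod, Fintype.card_fin]
        refine lt_of_le_of_lt (b := 2 * (n1 * n2) - 1) ?_ (by omega)
        apply Polynomial.natDegree_sum_le_of_forall_le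
        intro k _
        refine (Polynomial.natDegree_C_mul_X_pow_le _ _).trans ?_
        have := k.isLt
        omega
      · intro i
        obtain ⟨φ, ψ, h⟩ := hfun i
        have := congrArg φ hc
        simp only [map_sum, map_smul, map_zero] at this
        rw [← this]
        simp only [p, Polynomial.eval_finsetSum]
        refine Finset.sum_congr rfl fun k _ => ?_
        have := (h (k + 2)).1
        simp only [hw] at this
        simp [this]
      · intro i
        obtain ⟨φ, ψ, h⟩ := hfun i
        have := congrArg ψ hc
        simp only [map_sum, map_smul, map_zero] at this
        rw [← this]
        simp only [p, Polynomial.derivative_sum, Polynomial.eval_finsetSum]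
        refine Finset.sum_congr rfl fun k _ => ?_
        have := (h (k + 2)).2
        simp only [hw] at this
        rw [this]
        simp
        left; left; ring
    intro i
    have := congrArg (fun q => Polynomial.coeff q ((i : ℕ) + 2)) hp
    simp only [p, Polynomial.finsetSum_coeff, Polynomial.coeff_C_mul_X_pow,
      Polynomial.coeff_zero] at this
    rw [Finset.sum_eq_single i] at this
    · simpa using this
    · intro b _ hb
      rw [if_neg]
      intro h
      exact hb (Fin.ext (by omega))
    · simp
  · intro s hs hli
    obtain ⟨ho1, ho2⟩ := Nat.odd_mul.1 hodd
    obtain ⟨m1, hm1⟩ := ho1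
    obtain ⟨m2, hm2⟩ := ho2
    obtain ⟨φ, ψ, h⟩ := hfun (⟨m1, by omega⟩, ⟨m2, by omega⟩)
    have hl0 : l (⟨m1, by omega⟩, ⟨m2, by omega⟩) = 0 := by
      simp only [l]
      rw [hm1, hm2]; push_cast; ring
    rw [hl0] at h
    have hφ : ∀ k, 1 ≤ k → φ (w k) = 0 := fun k hk => by
      rw [(h k).1, zero_pow (by omega)]
    have hψ : ∀ k, 2 ≤ k → ψ (w k) = 0 := fun k hk => by
      rw [(h k).2, zero_pow (by omega), mul_zero]
    have hφ0 : φ (w 0) = 1 := by rw [(h 0).1, pow_zero]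
    have hψ0 : ψ (w 0) = 0 := by rw [(h 0).2]; simp
    have hψ1 : ψ (w 1) = 1 := by rw [(h 1).2]; simp
    have hbig : LinearIndependent ℝ (Sum.elim (Sum.elim
        (fun k : Fin (2 * (n1 * n2) - 2) => w ((k : ℕ) + 2)) (fun _ : Unit => w s))
        (fun k : Fin 2 => w k)) := by
      rw [Fintype.linearIndependent_iff] at hli ⊢
      intro c hc
      simp only [Fintype.sum_sum_type, Sum.elim_inl, Sum.elim_inr, Fin.sum_univ_two,
        Fin.val_zero, Fin.val_one] at hc
      have hc1 := congrArg φ hc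
      have hc2 := congrArg ψ hc
      simp only [map_add, map_sum, map_smul, map_zero, hφ0, hψ0, hψ1, hφ 1 le_rfl,
        hφ s (by omega), hψ s (by omega), fun k : ℕ => hφ (k + 2) (by omega),
        fun k : ℕ => hψ (k + 2) (by omega), smul_zero, Finset.sum_const_zero, zero_add,
        add_zero] at hc1 hc2
      have ha : c (Sum.inr 0) = 0 := by simpa using hc1
      have hb : c (Sum.inr 1) = 0 := by simpa using hc2
      have hc' := hli (fun i => c (Sum.inl i)) (by
        simp only [Fintype.sum_sum_type, Sum.elim_inl, Sum.elim_inr]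
        rw [ha, hb, zero_smul, zero_smul, add_zero, add_zero] at hc
        exact hc)
      rintro (i | i)
      · exact hc' i
      · fin_cases i
        · exact ha
        · exact hb
    have := hbig.fintype_card_le_finrank
    simp at this
    omega
end
end

section
/- Let n1, n2 ≥ 2 be integers with n1·n2 odd, let τ1, τ2 ∈ ℝ be such that there exist z1, z2 ∈ ℂ with z1² = τ1, z2² = τ2 and the pair (z1,z2) (n1,n2)-independent, and let s ≥ 2n1n2 be an integer. Then in the matrix M̄(s): (a) the column C̄_1(s) lies in the linear span of the odd-indexed columns C̄_3(s), C̄_5(s), …, C̄_{n1n2}(s); and (b) the column C̄_{n1n2+1}(s) lies in the linear span of the even-indexed columns C̄_{n1n2+3}(s), C̄_{n1n2+5}(s), …, C̄_{2n1n2}(s). -/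
open Matrix Kronecker

noncomputable section

/-- For `n1·n2` odd and `s ≥ 2n1n2`: the `(2n1n2-1) × (2n1n2)` matrix `M̄(s)` whose rows
are, in order, `e1·Q^2, e1·Q^3, …, e1·Q^{2n1n2-1}, e1·Q^s`. -/
def MbarS (n1 n2 : ℕ) (τ1 τ2 : ℝ) (s : ℕ) :
    Matrix (Fin (2 * (n1 * n2) - 1)) (Fin (2 * (n1 * n2))) ℝ :=
  Matrix.of fun i j =>
    Matrix.vecMul (e1v (2 * (n1 * n2)))
      (Qmat n1 n2 τ1 τ2 ^ (if (i : ℕ) + 2 < 2 * (n1 * n2) then (i : ℕ) + 2 else s)) j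

/-- The square matrix `M(s)` of order `2n1n2-1` obtained from `M̄(s)` by deleting its
first column. -/
def MmatS (n1 n2 : ℕ) (τ1 τ2 : ℝ) (s : ℕ) :
    Matrix (Fin (2 * (n1 * n2) - 1)) (Fin (2 * (n1 * n2) - 1)) ℝ :=
  Matrix.of fun i j =>
    MbarS n1 n2 τ1 τ2 s i ⟨(j : ℕ) + 1, by have := j.isLt; omega⟩

/-- The kernel sequence of the Kac matrix. -/
def kerSeq (n : ℕ) (y : ℝ) : ℕ → ℝ
  | 0 => 1
  | 1 => 0
  | (i + 2) => -(((n - 1 - i : ℕ) : ℝ) * y) * kerSeq n y i / ((i + 1 + 1 : ℕ) : ℝ)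

lemma kerSeq_odd (n : ℕ) (y : ℝ) (k : ℕ) : kerSeq n y (2 * k + 1) = 0 := by
  induction k with
  | zero => simp [kerSeq]
  | succ k ih =>
    have : 2 * (k + 1) + 1 = (2 * k + 1) + 2 := by ring
    rw [this, kerSeq, ih]; simp

lemma kerSeq_odd' (n : ℕ) (y : ℝ) (i : ℕ) (h : i % 2 = 1) : kerSeq n y i = 0 := by
  have : i = 2 * (i / 2) + 1 := by omega
  rw [this]; exact kerSeq_odd n y _

lemma kerSeq_rec (n : ℕ) (y : ℝ) (i : ℕ) :
    ((n - 1 - i : ℕ) : ℝ) * y * kerSeq n y i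
      + ((i + 1 + 1 : ℕ) : ℝ) * kerSeq n y (i + 2) = 0 := by
  rw [kerSeq]
  have : ((i + 1 + 1 : ℕ) : ℝ) ≠ 0 := by positivity
  field_simp
  ring

lemma kacM_ker (n : ℕ) (hn : n % 2 = 1) (y : ℝ) (i : Fin n) :
    ∑ j, kacM ℝ n y i j * kerSeq n y j = 0 := by
  rcases Nat.mod_two_eq_zero_or_one (i : ℕ) with hi | hi
  · apply Finset.sum_eq_zero
    intro j _
    rcases Nat.mod_two_eq_zero_or_one (j : ℕ) with hj | hj
    · have a1 : ¬ ((i : ℕ) = (j : ℕ) + 1) := by omega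
      have a2 : ¬ ((j : ℕ) = (i : ℕ) + 1) := by omega
      simp [kacM, a1, a2]
    · rw [kerSeq_odd' n y j hj, mul_zero]
  · have hlt := i.isLt
    obtain ⟨m, hm⟩ : ∃ m, (i : ℕ) = m + 1 := ⟨i - 1, by omega⟩
    have hb : m + 2 < n := by omega
    rw [Finset.sum_eq_add (⟨m, by omega⟩ : Fin n) (⟨m + 2, hb⟩ : Fin n)]
    · have := kerSeq_rec n y m
      simp only [kacM, Matrix.of_apply, hm]
      have c : ¬ (m + 1 = m + 2 + 1) := by omega
      simpa [c] using this
    · intro h; simp at h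
    · intro j _ hj
      have a1 : ¬ ((i : ℕ) = (j : ℕ) + 1) := by
        intro h; apply hj.1; ext; simp; omega
      have a2 : ¬ ((j : ℕ) = (i : ℕ) + 1) := by
        intro h; apply hj.2; ext; simp; omega
      simp [kacM, a1, a2]
    · simp
    · simp

lemma kac2M_eq (n1 n2 : ℕ) (x y : ℝ) (p q : Fin n1 × Fin n2) :
    kac2M ℝ n1 n2 x y p q =
      kacM ℝ n1 x p.1 q.1 * (if p.2 = q.2 then 1 else 0)
        + (if p.1 = q.1 then 1 else 0) * kacM ℝ n2 y p.2 q.2 := by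
  simp only [kac2M, Matrix.of_apply]
  by_cases h : p.1 = q.1
  · simp [h, kacM]
  · simp only [h, if_false, kacM, Matrix.of_apply]
    split_ifs <;> simp

lemma sum_prod_aux {a b : ℕ} (f : Fin a → ℝ) (g : Fin b → ℝ) :
    ∑ q : Fin a × Fin b, f q.1 * g q.2 = (∑ i, f i) * ∑ j, g j := by
  rw [Fintype.sum_prod_type, Finset.sum_mul_sum]

lemma kac2M_ker (n1 n2 : ℕ) (hn1 : n1 % 2 = 1) (hn2 : n2 % 2 = 1) (x y : ℝ)
    (p : Fin n1 × Fin n2) :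
    ∑ q, kac2M ℝ n1 n2 x y p q * (kerSeq n1 x q.1 * kerSeq n2 y q.2) = 0 := by
  have e : ∀ q : Fin n1 × Fin n2,
      kac2M ℝ n1 n2 x y p q * (kerSeq n1 x q.1 * kerSeq n2 y q.2) =
      (kacM ℝ n1 x p.1 q.1 * kerSeq n1 x q.1) * ((if p.2 = q.2 then 1 else 0) * kerSeq n2 y q.2)
      + ((if p.1 = q.1 then 1 else 0) * kerSeq n1 x q.1)
        * (kacM ℝ n2 y p.2 q.2 * kerSeq n2 y q.2) := by
    intro q; rw [kac2M_eq]; ring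
  rw [Finset.sum_congr rfl (fun q _ => e q), Finset.sum_add_distrib]
  rw [sum_prod_aux (fun a => kacM ℝ n1 x p.1 a * kerSeq n1 x a)
      (fun b => (if p.2 = b then 1 else 0) * kerSeq n2 y b),
    sum_prod_aux (fun a => (if p.1 = a then 1 else 0) * kerSeq n1 x a)
      (fun b => kacM ℝ n2 y p.2 b * kerSeq n2 y b),
    kacM_ker n1 hn1, kacM_ker n2 hn2, zero_mul, mul_zero, add_zero]

/-- Kernel vector of `K`. -/
def kerW (n1 n2 : ℕ) (x y : ℝ) : Fin (n1 * n2) → ℝ := fun j =>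
  kerSeq n1 x (finProdFinEquiv.symm j).1 * kerSeq n2 y (finProdFinEquiv.symm j).2

lemma kac2Fin_ker (n1 n2 : ℕ) (hn1 : n1 % 2 = 1) (hn2 : n2 % 2 = 1) (x y : ℝ) :
    kac2Fin n1 n2 x y *ᵥ kerW n1 n2 x y = 0 := by
  ext i
  rw [Matrix.mulVec, dotProduct, ← finProdFinEquiv.sum_comp]
  simp only [kac2Fin, kerW, Matrix.reindex_apply, Matrix.submatrix_apply,
    Equiv.symm_apply_apply, Pi.zero_apply]
  exact kac2M_ker n1 n2 hn1 hn2 x y _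

lemma kerW_odd (n1 n2 : ℕ) (hn2 : n2 % 2 = 1) (x y : ℝ) (j : Fin (n1 * n2))
    (hj : (j : ℕ) % 2 = 1) : kerW n1 n2 x y j = 0 := by
  obtain ⟨q, rfl⟩ := finProdFinEquiv.surjective j
  simp only [kerW, Equiv.symm_apply_apply]
  rw [finProdFinEquiv_apply_val, Nat.add_mod, Nat.mul_mod, hn2] at hj
  rcases Nat.mod_two_eq_zero_or_one (q.1 : ℕ) with h | h
  · rw [kerSeq_odd' n2 y _ (by omega), mul_zero]
  · rw [kerSeq_odd' n1 x _ h, zero_mul]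

lemma kerW_zero (n1 n2 : ℕ) (x y : ℝ) (j : Fin (n1 * n2)) (hj : (j : ℕ) = 0) :
    kerW n1 n2 x y j = 1 := by
  obtain ⟨q, rfl⟩ := finProdFinEquiv.surjective j
  simp only [kerW, Equiv.symm_apply_apply]
  rw [finProdFinEquiv_apply_val] at hj
  have hq : 0 < n2 := by have := q.2.isLt; omega
  have a : (q.2 : ℕ) = 0 := by omega
  have b : (q.1 : ℕ) = 0 := by
    rw [a, zero_add] at hj
    rcases Nat.mul_eq_zero.mp hj with h | h
    · omega
    · exact h
  simp [a, b, kerSeq]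

/-- Index equivalence used for `Qmat`. -/
abbrev qE (N : ℕ) : Fin N ⊕ Fin N ≃ Fin (2 * N) :=
  finSumFinEquiv.trans (finCongr (two_mul N).symm)

lemma Qmat_mulVec (n1 n2 : ℕ) (x y : ℝ) (f : Fin (n1 * n2) ⊕ Fin (n1 * n2) → ℝ) :
    Qmat n1 n2 x y *ᵥ (f ∘ (qE _).symm) =
      (Matrix.fromBlocks (kac2Fin n1 n2 x y) 1 0 (kac2Fin n1 n2 x y) *ᵥ f) ∘ (qE _).symm := by
  ext i
  rw [Matrix.mulVec, dotProduct, ← (qE (n1 * n2)).sum_comp]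
  simp only [Qmat, Matrix.reindex_apply, Matrix.submatrix_apply, Function.comp,
    Equiv.symm_apply_apply]
  rfl

lemma Q_sq_a (n1 n2 : ℕ) (hn1 : n1 % 2 = 1) (hn2 : n2 % 2 = 1) (x y : ℝ) :
    Qmat n1 n2 x y *ᵥ (Sum.elim (kerW n1 n2 x y) 0 ∘ (qE _).symm) = 0 := by
  rw [Qmat_mulVec, Matrix.fromBlocks_mulVec]
  rw [Sum.elim_comp_inl, Sum.elim_comp_inr, kac2Fin_ker n1 n2 hn1 hn2]
  ext i
  simp only [Function.comp]
  rcases (qE (n1 * n2)).symm i with k | k <;> simp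

lemma Q_sq_b (n1 n2 : ℕ) (hn1 : n1 % 2 = 1) (hn2 : n2 % 2 = 1) (x y : ℝ) :
    Qmat n1 n2 x y *ᵥ (Sum.elim 0 (kerW n1 n2 x y) ∘ (qE _).symm) =
      (Sum.elim (kerW n1 n2 x y) 0 ∘ (qE _).symm) := by
  rw [Qmat_mulVec, Matrix.fromBlocks_mulVec]
  congr 1
  rw [Sum.elim_comp_inl, Sum.elim_comp_inr, kac2Fin_ker n1 n2 hn1 hn2]
  simp

lemma span_aux (n1 n2 : ℕ) (x y : ℝ) (s : ℕ) (hs : 2 ≤ s)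
    (V : Fin (2 * (n1 * n2)) → ℝ)
    (hV : Qmat n1 n2 x y *ᵥ (Qmat n1 n2 x y *ᵥ V) = 0) (j0 : Fin (2 * (n1 * n2)))
    (hj0 : V j0 = 1) (P : Set (Fin (2 * (n1 * n2)) )) (hP : ∀ j, j ≠ j0 → V j ≠ 0 → j ∈ P) :
    (fun i => MbarS n1 n2 x y s i j0) ∈
      Submodule.span ℝ {v | ∃ j ∈ P, v = fun i => MbarS n1 n2 x y s i j} := by
  have key : ∀ i, ∑ j, MbarS n1 n2 x y s i j * V j = 0 := by
    intro i
    simp only [MbarS, Matrix.of_apply]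
    change (e1v _ ᵥ* _) ⬝ᵥ V = 0
    rw [← Matrix.dotProduct_mulVec]
    obtain ⟨k, hk⟩ : ∃ k, (if (i : ℕ) + 2 < 2 * (n1 * n2) then (i : ℕ) + 2 else s) = k + 2 := by
      split_ifs
      · exact ⟨_, rfl⟩
      · exact ⟨s - 2, by omega⟩
    rw [hk, pow_add, pow_two, ← Matrix.mulVec_mulVec, ← Matrix.mulVec_mulVec, hV]
    simp
  have e : (fun i => MbarS n1 n2 x y s i j0) =
      ∑ j ∈ Finset.univ.erase j0, (-V j) • (fun i => MbarS n1 n2 x y s i j) := by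
    ext i
    have := key i
    rw [← Finset.add_sum_erase _ _ (Finset.mem_univ j0), hj0, mul_one] at this
    rw [Finset.sum_apply]
    simp only [Pi.smul_apply, smul_eq_mul, neg_mul, Finset.sum_neg_distrib]
    rw [Finset.sum_congr rfl (fun j _ => mul_comm (V j) _)]
    linarith
  rw [e]
  apply Submodule.sum_mem
  intro j hj
  by_cases h : V j = 0
  · simp [h]
  · exact Submodule.smul_mem _ _
      (Submodule.subset_span ⟨j, hP j (Finset.ne_of_mem_erase hj) h, rfl⟩)

/-- For `n1·n2` odd, `τ1 = z1²`, `τ2 = z2²` with `(z1,z2)`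
`(n1,n2)`-independent, and `s ≥ 2n1n2`: (a) the first column `C̄_1(s)` of `M̄(s)` lies in
the span of the odd-indexed columns `C̄_3(s), C̄_5(s), …, C̄_{n1n2}(s)`; (b) the column
`C̄_{n1n2+1}(s)` lies in the span of the even-indexed columns
`C̄_{n1n2+3}(s), …, C̄_{2n1n2}(s)`.  (Column indices are 1-based: the 1-based column `c`
is the 0-based column `c-1`.) -/
theorem MbarS_column_relations (n1 n2 : ℕ) (h1 : 2 ≤ n1) (h2 : 2 ≤ n2)
    (hodd : Odd (n1 * n2)) (τ1 τ2 : ℝ) (z1 z2 : ℂ)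
    (hz1 : z1 ^ 2 = (τ1 : ℂ)) (hz2 : z2 ^ 2 = (τ2 : ℂ))
    (hind : IndepPair n1 n2 z1 z2) (s : ℕ) (hs : 2 * (n1 * n2) ≤ s) :
    ((fun i => MbarS n1 n2 τ1 τ2 s i
        ⟨0, by have := Nat.mul_pos (by omega : 0 < n1) (by omega : 0 < n2); omega⟩) ∈
      Submodule.span ℝ {v : Fin (2 * (n1 * n2) - 1) → ℝ |
        ∃ j : Fin (2 * (n1 * n2)), (j : ℕ) % 2 = 0 ∧ 2 ≤ (j : ℕ) ∧ (j : ℕ) ≤ n1 * n2 - 1 ∧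
          v = fun i => MbarS n1 n2 τ1 τ2 s i j}) ∧
    ((fun i => MbarS n1 n2 τ1 τ2 s i
        ⟨n1 * n2, by have := Nat.mul_pos (by omega : 0 < n1) (by omega : 0 < n2); omega⟩) ∈
      Submodule.span ℝ {v : Fin (2 * (n1 * n2) - 1) → ℝ |
        ∃ j : Fin (2 * (n1 * n2)), (j : ℕ) % 2 = 1 ∧ n1 * n2 + 2 ≤ (j : ℕ) ∧
          v = fun i => MbarS n1 n2 τ1 τ2 s i j}) := by
  have hN := Nat.mul_pos (by omega : 0 < n1) (by omega : 0 < n2)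
  have ho := Nat.odd_mul.mp hodd
  have hn1 := Nat.odd_iff.mp ho.1
  have hn2 := Nat.odd_iff.mp ho.2
  have hNo := Nat.odd_iff.mp hodd
  have hl : ∀ k : Fin (n1 * n2), ((qE (n1 * n2) (Sum.inl k) : Fin _) : ℕ) = k := by
    intro k; simp [qE]
  have hr : ∀ k : Fin (n1 * n2), ((qE (n1 * n2) (Sum.inr k) : Fin _) : ℕ) = n1 * n2 + k := by
    intro k; simp [qE, add_comm]
  constructor
  · have := span_aux n1 n2 τ1 τ2 s (by omega) (Sum.elim (kerW n1 n2 τ1 τ2) 0 ∘ (qE _).symm)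
      (by rw [Q_sq_a n1 n2 hn1 hn2]; simp) ⟨0, by omega⟩
      (by
        have e : (⟨0, by omega⟩ : Fin (2 * (n1 * n2))) = qE _ (Sum.inl ⟨0, hN⟩) := by
          ext; rw [hl]
        rw [e, Function.comp, Equiv.symm_apply_apply, Sum.elim_inl]
        exact kerW_zero _ _ _ _ _ rfl)
      {j | (j : ℕ) % 2 = 0 ∧ 2 ≤ (j : ℕ) ∧ (j : ℕ) ≤ n1 * n2 - 1}
      (by
        intro j hj hV
        obtain ⟨k | k, rfl⟩ := (qE (n1 * n2)).surjective j
        · rw [Function.comp, Equiv.symm_apply_apply, Sum.elim_inl] at hV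
          have hk : (k : ℕ) % 2 = 0 := by
            by_contra h
            exact hV (kerW_odd n1 n2 hn2 _ _ k (by omega))
          have hne : (k : ℕ) ≠ 0 := by
            intro h; apply hj; ext; rw [hl, h]
          have := k.isLt
          rw [Set.mem_ofPred_eq, hl]
          omega
        · rw [Function.comp, Equiv.symm_apply_apply, Sum.elim_inr] at hV
          exact absurd rfl hV)
    refine Submodule.span_mono ?_ this
    rintro v ⟨j, ⟨a, b, c⟩, rfl⟩
    exact ⟨j, a, b, c, rfl⟩
  · have := span_aux n1 n2 τ1 τ2 s (by omega) (Sum.elim 0 (kerW n1 n2 τ1 τ2) ∘ (qE _).symm)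
      (by rw [Q_sq_b n1 n2 hn1 hn2, Q_sq_a n1 n2 hn1 hn2]) ⟨n1 * n2, by omega⟩
      (by
        have e : (⟨n1 * n2, by omega⟩ : Fin (2 * (n1 * n2))) = qE _ (Sum.inr ⟨0, hN⟩) := by
          ext; rw [hr]; rfl
        rw [e, Function.comp, Equiv.symm_apply_apply, Sum.elim_inr]
        exact kerW_zero _ _ _ _ _ rfl)
      {j | (j : ℕ) % 2 = 1 ∧ n1 * n2 + 2 ≤ (j : ℕ)}
      (by
        intro j hj hV
        obtain ⟨k | k, rfl⟩ := (qE (n1 * n2)).surjective j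
        · rw [Function.comp, Equiv.symm_apply_apply, Sum.elim_inl] at hV
          exact absurd rfl hV
        · rw [Function.comp, Equiv.symm_apply_apply, Sum.elim_inr] at hV
          have hk : (k : ℕ) % 2 = 0 := by
            by_contra h
            exact hV (kerW_odd n1 n2 hn2 _ _ k (by omega))
          have hne : (k : ℕ) ≠ 0 := by
            intro h; apply hj; ext; rw [hr, h]; rfl
          rw [Set.mem_ofPred_eq, hr]
          omega)
    refine Submodule.span_mono ?_ this
    rintro v ⟨j, ⟨a, b⟩, rfl⟩
    exact ⟨j, a, b, rfl⟩
end
end
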